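/- Let λ and μ be two elements of C. The following are equivalent: (1) λ and μ lie in the same orbit under the group of affine transformations of V of the form v ↦ w(v) + l with w ∈ W and l ∈ L; (2) there exists z ∈ 𝒜_L such that z(λ) − μ ∈ L. -/

import Mathlib

open Module

/-- A reduced, irreducible, crystallographic root system `Φ` inside the dual of a
`ℚ`-vector space `V`: each root `α` has a coroot `α∨ ∈ V` with `⟨α, α∨⟩ = 2`, pairings
between roots and coroots are integers, the dual reflections permute the roots, the
system is reduced, the roots span `V*`, and the system is irreducible. -/
structure RootSystemData (V : Type*) [AddCommGroup V] [Module ℚ V] where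
  Φ : Set (Module.Dual ℚ V)
  coroot : Module.Dual ℚ V → V
  finite : Φ.Finite
  span_eq_top : Submodule.span ℚ Φ = ⊤
  pairing_self : ∀ α ∈ Φ, α (coroot α) = 2
  pairing_int : ∀ α ∈ Φ, ∀ β ∈ Φ, ∃ n : ℤ, (n : ℚ) = β (coroot α)
  reduced : ∀ α ∈ Φ, ∀ c : ℚ, c • α ∈ Φ → c = 1 ∨ c = -1
  dual_refl_mem : ∀ α ∈ Φ, ∀ β ∈ Φ, β - β (coroot α) • α ∈ Φ
  irreducible : ∀ s : Set (Module.Dual ℚ V), s ⊆ Φ → s.Nonempty →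
      (∀ α ∈ s, ∀ β ∈ Φ, β ∉ s → β (coroot α) = 0) → s = Φ

variable {V : Type*} [AddCommGroup V] [Module ℚ V]

/-- The reflections `s_α : v ↦ v - ⟨α, v⟩ α∨` attached to the elements `α` of `S`. -/
def reflSet (R : RootSystemData V) (S : Set (Module.Dual ℚ V)) : Set (V ≃ₗ[ℚ] V) :=
  {w | ∃ α ∈ S, ∀ v, w v = v - α v • R.coroot α}

/-- The subgroup of `GL(V)` generated by the reflections `s_α`, `α ∈ S`. -/
def weylOf (R : RootSystemData V) (S : Set (Module.Dual ℚ V)) : Subgroup (V ≃ₗ[ℚ] V) :=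
  Subgroup.closure (reflSet R S)

/-- The Weyl group `W` of the root system. -/
def weyl (R : RootSystemData V) : Subgroup (V ≃ₗ[ℚ] V) :=
  weylOf R R.Φ

/-- The contragredient action of `w ∈ GL(V)` on the dual space: `β ↦ β ∘ w⁻¹`. -/
def dact (w : V ≃ₗ[ℚ] V) (β : Module.Dual ℚ V) : Module.Dual ℚ V :=
  β.comp (w.symm.toLinearMap)

/-- The coroot lattice `Q∨`. -/
def corootLattice (R : RootSystemData V) : AddSubgroup V :=
  AddSubgroup.closure (R.coroot '' R.Φ)

/-- The coweight lattice `P∨ = {v ∈ V | ⟨α, v⟩ ∈ ℤ for all α ∈ Φ}`, as a set. -/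
def coweightSet (R : RootSystemData V) : Set V :=
  {v | ∀ α ∈ R.Φ, ∃ n : ℤ, (n : ℚ) = α v}

/-- `m_α`: equal to `-1` on `α₀ = -α̃` and `0` elsewhere (in particular on `Δ`). -/
noncomputable def mfun (αt α : Module.Dual ℚ V) : ℚ := by
  classical exact if α = -αt then -1 else 0

/-- The extended (affine) base `Δ̃ = Δ ∪ {-α̃}`. -/
def extBase (Δ : Finset (Module.Dual ℚ V)) (αt : Module.Dual ℚ V) :
    Set (Module.Dual ℚ V) :=
  insert (-αt) (Δ : Set (Module.Dual ℚ V))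

/-- The closed fundamental alcove `C = {λ ∈ V | ⟨α, λ⟩ ≥ m_α for all α ∈ Δ̃}`. -/
def alcove (Δ : Finset (Module.Dual ℚ V)) (αt : Module.Dual ℚ V) : Set V :=
  {x | ∀ α ∈ extBase Δ αt, mfun αt α ≤ α x}

/-- `Φ(λ) = {α ∈ Φ | ⟨α, λ⟩ ∈ ℤ}`. -/
def PhiOf (R : RootSystemData V) (x : V) : Set (Module.Dual ℚ V) :=
  {α | α ∈ R.Φ ∧ ∃ k : ℤ, (k : ℚ) = α x}

/-- `I_λ = {α ∈ Δ̃ | ⟨α, λ⟩ = m_α}` for `λ ∈ C`. -/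
def IOf (Δ : Finset (Module.Dual ℚ V)) (αt : Module.Dual ℚ V) (x : V) :
    Set (Module.Dual ℚ V) :=
  {α | α ∈ extBase Δ αt ∧ α x = mfun αt α}

/-- `W°(λ)`: the subgroup of `W` generated by the reflections `s_α`, `α ∈ Φ(λ)`. -/
def Wcirc (R : RootSystemData V) (x : V) : Subgroup (V ≃ₗ[ℚ] V) :=
  weylOf R (PhiOf R x)

/-- `𝒜 = {z ∈ W | z(Δ̃) = Δ̃}`: automorphisms of the affine Dynkin diagram induced by `W`. -/
def AutTilde (R : RootSystemData V) (Δ : Finset (Module.Dual ℚ V))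
    (αt : Module.Dual ℚ V) : Set (V ≃ₗ[ℚ] V) :=
  {z | z ∈ weyl R ∧ dact z '' extBase Δ αt = extBase Δ αt}

/-- `𝒜_L = {z ∈ 𝒜 | ϖ∨(z) ∈ L}`, where `ϖ∨(z)` is the unique `v` with `z(C) + v = C`. -/
def AutTildeL (R : RootSystemData V) (Δ : Finset (Module.Dual ℚ V))
    (αt : Module.Dual ℚ V) (L : AddSubgroup V) : Set (V ≃ₗ[ℚ] V) :=
  {z | z ∈ AutTilde R Δ αt ∧
    ∃ v ∈ L, (fun x => z x + v) '' alcove Δ αt = alcove Δ αt}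

/-- The submodule of vectors of `V` fixed by every element of `S`. -/
def fixedSub (S : Set (V ≃ₗ[ℚ] V)) : Submodule ℚ V where
  carrier := {v | ∀ w ∈ S, w v = v}
  add_mem' := by
    intro a b ha hb w hw
    rw [map_add, ha w hw, hb w hw]
  zero_mem' := by
    intro w hw
    exact map_zero w
  smul_mem' := by
    intro c v hv w hw
    rw [map_smul, hv w hw]

/-- The set of orbits of a subgroup `A ≤ GL(V)` acting (contragrediently) on a set `S`
of linear forms. -/
def orbitsOn (A : Subgroup (V ≃ₗ[ℚ] V)) (S : Set (Module.Dual ℚ V)) :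
    Set (Set (Module.Dual ℚ V)) :=
  {O | ∃ α ∈ S, O = {β | ∃ z ∈ A, dact z α = β}}

/-- `λ_Ω = (1/(n_Ω·|Ω|))·Σ_{α∈Ω} ϖ_α∨` (written with `n_α` in place of the constant value
`n_Ω` of `n` on `Ω`). -/
noncomputable def lamOf (n : Module.Dual ℚ V → ℕ) (ϖ : Module.Dual ℚ V → V)
    (Ω : Set (Module.Dual ℚ V)) : V :=
  ∑ᶠ α ∈ Ω, ((n α : ℚ) * (Ω.ncard : ℚ))⁻¹ • ϖ α

/-- `λ` is quasi-isolated with respect to `L` if the only vector fixed by every element of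
`W_L(λ) = {w ∈ W | w(λ) - λ ∈ L}` is `0`. -/
def IsQuasiIsolated (R : RootSystemData V) (L : AddSubgroup V) (x : V) : Prop :=
  fixedSub {w : V ≃ₗ[ℚ] V | w ∈ weyl R ∧ w x - x ∈ L} = ⊥

/-- `𝒬_L`: the set of nonempty subsets `Ω ⊆ Δ̃` whose stabilizer in `𝒜_L` acts
transitively on `Ω`. -/
def QSetOf (R : RootSystemData V) (Δ : Finset (Module.Dual ℚ V))
    (αt : Module.Dual ℚ V) (L : AddSubgroup V) : Set (Set (Module.Dual ℚ V)) :=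
  {Ω | Ω ⊆ extBase Δ αt ∧ Ω.Nonempty ∧
    ∀ α ∈ Ω, ∀ β ∈ Ω, ∃ z ∈ AutTildeL R Δ αt L, dact z '' Ω = Ω ∧ dact z α = β}

namespace RootSystemData

variable (R : RootSystemData V)

lemma ne_zero {α : Module.Dual ℚ V} (hα : α ∈ R.Φ) : α ≠ 0 := by
  rintro rfl
  simpa using R.pairing_self _ hα

lemma neg_mem {α : Module.Dual ℚ V} (hα : α ∈ R.Φ) : -α ∈ R.Φ := by
  have h := R.dual_refl_mem α hα α hα
  rw [R.pairing_self α hα, two_smul] at h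
  simpa using h

/-- The reflection `s_α` as an element of `GL(V)`. -/
def refl {α : Module.Dual ℚ V} (hα : α ∈ R.Φ) : V ≃ₗ[ℚ] V :=
  Module.reflection (R.pairing_self α hα)

lemma refl_apply {α : Module.Dual ℚ V} (hα : α ∈ R.Φ) (v : V) :
    R.refl hα v = v - α v • R.coroot α :=
  Module.reflection_apply _ _

lemma refl_mem_weyl {α : Module.Dual ℚ V} (hα : α ∈ R.Φ) : R.refl hα ∈ weyl R :=
  Subgroup.subset_closure ⟨α, hα, R.refl_apply hα⟩

lemma comp_refl_mem {α β : Module.Dual ℚ V} (hα : α ∈ R.Φ) (hβ : β ∈ R.Φ) :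
    β.comp (R.refl hα).toLinearMap ∈ R.Φ := by
  convert R.dual_refl_mem α hα β hβ using 1
  ext v
  simp [refl_apply, mul_comm]

lemma comp_mem_of_mem_weyl {w : V ≃ₗ[ℚ] V} (hw : w ∈ weyl R) :
    (∀ β ∈ R.Φ, β.comp w.toLinearMap ∈ R.Φ) ∧ ∀ β ∈ R.Φ, dact w β ∈ R.Φ := by
  induction hw using Subgroup.closure_induction with
  | mem s hs =>
    obtain ⟨α, hα, hs⟩ := hs
    obtain rfl : s = R.refl hα := LinearEquiv.ext fun v => by rw [hs, refl_apply]
    refine ⟨fun β hβ => R.comp_refl_mem hα hβ, fun β hβ => ?_⟩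
    rw [dact, refl, Module.reflection_symm]
    exact R.comp_refl_mem hα hβ
  | one => exact ⟨fun β hβ => hβ, fun β hβ => hβ⟩
  | mul a b _ _ ha hb => exact ⟨fun β hβ => hb.1 _ (ha.1 β hβ), fun β hβ => ha.2 _ (hb.2 β hβ)⟩
  | inv a _ ha => exact ⟨ha.2, ha.1⟩

/-- The canonical `W`-invariant bilinear form `∑_β β(u) β(v)`. -/
noncomputable def form (u v : V) : ℚ := ∑ β ∈ R.finite.toFinset, β u * β v

lemma form_refl {α : Module.Dual ℚ V} (hα : α ∈ R.Φ) (u v : V) :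
    R.form (R.refl hα u) (R.refl hα v) = R.form u v := by
  have hinv (v : V) : R.refl hα (R.refl hα v) = v := Module.involutive_reflection _ v
  refine Finset.sum_bij' (fun β _ => β.comp (R.refl hα).toLinearMap)
    (fun β _ => β.comp (R.refl hα).toLinearMap) ?_ ?_ ?_ ?_ ?_
  · exact fun β hβ => by simpa using R.comp_refl_mem hα (by simpa using hβ)
  · exact fun β hβ => by simpa using R.comp_refl_mem hα (by simpa using hβ)
  · exact fun β _ => by ext v; simp [hinv]
  · exact fun β _ => by ext v; simp [hinv]
  · exact fun β _ => by simp

lemma form_sub_smul (u v : V) (c : ℚ) :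
    R.form (u - c • v) (u - c • v) = R.form u u - 2 * c * R.form u v + c ^ 2 * R.form v v := by
  simp only [form, Finset.mul_sum, ← Finset.sum_sub_distrib, ← Finset.sum_add_distrib]
  refine Finset.sum_congr rfl fun β _ => ?_
  simp only [map_sub, map_smul, smul_eq_mul]
  ring

lemma two_mul_form_coroot {α : Module.Dual ℚ V} (hα : α ∈ R.Φ) (u : V) :
    2 * R.form u (R.coroot α) = α u * R.form (R.coroot α) (R.coroot α) := by
  have h := R.form_refl hα u (R.coroot α)
  have h' : R.refl hα (R.coroot α) = -R.coroot α := by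
    rw [refl_apply, R.pairing_self α hα, two_smul]; abel
  rw [h', refl_apply] at h
  have h2 : R.form (u - α u • R.coroot α) (-R.coroot α) =
      -R.form u (R.coroot α) + α u * R.form (R.coroot α) (R.coroot α) := by
    simp only [form, Finset.mul_sum, ← Finset.sum_neg_distrib, ← Finset.sum_add_distrib]
    refine Finset.sum_congr rfl fun β _ => ?_
    simp only [map_sub, map_smul, smul_eq_mul, map_neg]
    ring
  linarith

lemma form_coroot_pos {α : Module.Dual ℚ V} (hα : α ∈ R.Φ) :
    0 < R.form (R.coroot α) (R.coroot α) := by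
  refine Finset.sum_pos' (fun β _ => mul_self_nonneg _) ⟨α, by simpa using hα, ?_⟩
  rw [R.pairing_self α hα]
  norm_num

/-- Reflecting a point across a hyperplane `α = m` brings it closer to any point on the
other side. -/
lemma form_affine_refl_lt {α : Module.Dual ℚ V} (hα : α ∈ R.Φ) {m : ℚ} {p q : V}
    (hp : m < α p) (hq : α q < m) :
    R.form (q - (α q - m) • R.coroot α - p) (q - (α q - m) • R.coroot α - p) <
      R.form (q - p) (q - p) := by
  have e : q - (α q - m) • R.coroot α - p = (q - p) - (α q - m) • R.coroot α := by abel
  rw [e, form_sub_smul]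
  have h1 := R.two_mul_form_coroot hα (q - p)
  have h2 := mul_pos (mul_pos (sub_pos.2 hp) (sub_pos.2 hq)) (R.form_coroot_pos hα)
  rw [map_sub] at h1
  linear_combination h2 - (α q - m) * h1

lemma exists_common_denominator (p : V) :
    ∃ N : ℤ, N ≠ 0 ∧ ∀ β ∈ R.Φ, ∃ k : ℤ, (k : ℚ) = N * β p := by
  obtain ⟨b, hb⟩ := IsLocalization.exist_integer_multiples_of_finset (nonZeroDivisors ℤ)
    (R.finite.toFinset.image fun β => β p)
  refine ⟨b, nonZeroDivisors.coe_ne_zero b, fun β hβ => ?_⟩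
  obtain ⟨k, hk⟩ := hb (β p) (Finset.mem_image_of_mem _ (by simpa using hβ))
  exact ⟨k, by simpa using hk⟩

/-- The squared distances from `p` to the points of its orbit under the extended affine Weyl
group have a common denominator. -/
lemma exists_nat_eq_mul_form {p : V} {N : ℤ}
    (hN : ∀ β ∈ R.Φ, ∃ k : ℤ, (k : ℚ) = N * β p) {w : V ≃ₗ[ℚ] V} (hw : w ∈ weyl R) {l : V}
    (hl : l ∈ coweightSet R) :
    ∃ n : ℕ, (n : ℚ) = N ^ 2 * R.form (w p + l - p) (w p + l - p) := by
  have hsq : ∀ β ∈ R.finite.toFinset, ∃ k : ℕ,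
      (k : ℚ) = N ^ 2 * (β (w p + l - p) * β (w p + l - p)) := by
    intro β hβ
    replace hβ : β ∈ R.Φ := by simpa using hβ
    obtain ⟨a, ha⟩ := hN _ ((R.comp_mem_of_mem_weyl hw).1 β hβ)
    obtain ⟨b, hb⟩ := hl β hβ
    obtain ⟨d, hd⟩ := hN β hβ
    replace ha : (a : ℚ) = N * β (w p) := ha
    refine ⟨((a + N * b - d) ^ 2).toNat, ?_⟩
    rw [← Int.cast_natCast, Int.toNat_of_nonneg (sq_nonneg _), map_sub, map_add, ← hb]
    push_cast
    rw [ha, hd]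
    ring
  choose! k hk using hsq
  refine ⟨∑ β ∈ R.finite.toFinset, k β, ?_⟩
  rw [Nat.cast_sum, Finset.sum_congr rfl hk, ← Finset.mul_sum]
  rfl

end RootSystemData

/-- `Δ` is a base of the root system with highest root `αt`. -/
structure IsBaseWithHighestRoot (R : RootSystemData V) (Δ : Finset (Module.Dual ℚ V))
    (αt : Module.Dual ℚ V) : Prop where
  subset : (Δ : Set (Module.Dual ℚ V)) ⊆ R.Φ
  linearIndependent : LinearIndependent ℚ
    (fun x : (Δ : Set (Module.Dual ℚ V)) => (x : Module.Dual ℚ V))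
  exists_coeff : ∀ α ∈ R.Φ, ∃ c : Module.Dual ℚ V →₀ ℤ,
    (c.support : Set (Module.Dual ℚ V)) ⊆ (Δ : Set (Module.Dual ℚ V)) ∧
    α = c.sum (fun β k => (k : ℚ) • β) ∧ ((∀ β, 0 ≤ c β) ∨ (∀ β, c β ≤ 0))
  highest_mem : αt ∈ R.Φ
  highest : ∀ γ ∈ R.Φ, ∃ c : Module.Dual ℚ V →₀ ℚ,
    (c.support : Set (Module.Dual ℚ V)) ⊆ (Δ : Set (Module.Dual ℚ V)) ∧
    αt - γ = c.sum (fun β k => k • β) ∧ (∀ β, 0 ≤ c β)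
  neg_highest_notMem : -αt ∉ (Δ : Set (Module.Dual ℚ V))

lemma mfun_neg_self (αt : Module.Dual ℚ V) : mfun αt (-αt) = -1 := by
  simp [mfun]

lemma exists_int_eq_mfun (αt α : Module.Dual ℚ V) : ∃ m : ℤ, (m : ℚ) = mfun αt α := by
  unfold mfun
  split_ifs
  · exact ⟨-1, by simp⟩
  · exact ⟨0, by simp⟩

/-- An integer translate of a root of constant sign and absolute value at most one on a set
cannot change sign on this set. -/
lemma le_add_int_of_mem_Icc {a b : ℚ}
    (h : (0 < a ∧ a < 1 ∧ 0 ≤ b ∧ b ≤ 1) ∨ (-1 < a ∧ a < 0 ∧ -1 ≤ b ∧ b ≤ 0)) (n m : ℤ) :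
    ((m : ℚ) ≤ a + n → (m : ℚ) ≤ b + n) ∧ (a + n < m → b + n ≤ m) := by
  rcases h with ⟨h1, h2, h3, h4⟩ | ⟨h1, h2, h3, h4⟩
  · constructor <;> intro h
    · have : m < n + 1 := by exact_mod_cast (by linarith : (m : ℚ) < n + 1)
      have : (m : ℚ) ≤ n := by exact_mod_cast Int.lt_add_one_iff.1 this
      linarith
    · have : n < m := by exact_mod_cast (by linarith : (n : ℚ) < m)
      have : (n : ℚ) + 1 ≤ m := by exact_mod_cast this
      linarith
  · constructor <;> intro h
    · have : m < n := by exact_mod_cast (by linarith : (m : ℚ) < n)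
      have : (m : ℚ) + 1 ≤ n := by exact_mod_cast this
      linarith
    · have : n < m + 1 := by exact_mod_cast (by linarith : (n : ℚ) < m + 1)
      have : (n : ℚ) ≤ m := by exact_mod_cast Int.lt_add_one_iff.1 this
      linarith

namespace IsBaseWithHighestRoot

variable {R : RootSystemData V} {Δ : Finset (Module.Dual ℚ V)} {αt : Module.Dual ℚ V}

lemma mfun_of_mem (h : IsBaseWithHighestRoot R Δ αt) {α : Module.Dual ℚ V} (hα : α ∈ Δ) :
    mfun αt α = 0 := by
  have : α ≠ -αt := by
    rintro rfl
    exact h.neg_highest_notMem hα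
  simp [mfun, this]

lemma extBase_subset (h : IsBaseWithHighestRoot R Δ αt) : extBase Δ αt ⊆ R.Φ :=
  Set.insert_subset (R.neg_mem h.highest_mem) h.subset

lemma mem_alcove_iff (h : IsBaseWithHighestRoot R Δ αt) {x : V} :
    x ∈ alcove Δ αt ↔ (∀ δ ∈ Δ, 0 ≤ δ x) ∧ αt x ≤ 1 := by
  constructor
  · intro hx
    refine ⟨fun δ hδ => ?_, ?_⟩
    · simpa [h.mfun_of_mem hδ] using hx δ (Set.mem_insert_of_mem _ hδ)
    · simpa [mfun_neg_self] using hx (-αt) (Set.mem_insert _ _)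
  · rintro ⟨h1, h2⟩ δ (rfl | hδ)
    · simpa [mfun_neg_self] using h2
    · rw [h.mfun_of_mem hδ]
      exact h1 δ hδ

lemma nonneg_or_nonpos (h : IsBaseWithHighestRoot R Δ αt) {β : Module.Dual ℚ V}
    (hβ : β ∈ R.Φ) :
    (∀ v, (∀ δ ∈ Δ, 0 ≤ δ v) → 0 ≤ β v) ∨ (∀ v, (∀ δ ∈ Δ, 0 ≤ δ v) → β v ≤ 0) := by
  obtain ⟨c, hc, rfl, hs⟩ := h.exists_coeff β hβ
  refine hs.imp (fun hs v hv => ?_) (fun hs v hv => ?_) <;>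
    simp only [Finsupp.sum, LinearMap.sum_apply, LinearMap.smul_apply, smul_eq_mul]
  · exact Finset.sum_nonneg fun δ hδ => mul_nonneg (by exact_mod_cast hs δ) (hv δ (hc hδ))
  · exact Finset.sum_nonpos fun δ hδ =>
      mul_nonpos_of_nonpos_of_nonneg (by exact_mod_cast hs δ) (hv δ (hc hδ))

lemma apply_ne_zero (h : IsBaseWithHighestRoot R Δ αt) {β : Module.Dual ℚ V} (hβ : β ∈ R.Φ)
    {v : V} (hv : ∀ δ ∈ Δ, 0 < δ v) : β v ≠ 0 := by
  obtain ⟨c, hc, hβc, hs⟩ := h.exists_coeff β hβ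
  have hne : c.support.Nonempty := by
    rw [Finsupp.support_nonempty_iff]
    rintro rfl
    exact R.ne_zero hβ (by simpa using hβc)
  have e : β v = ∑ δ ∈ c.support, (c δ : ℚ) * δ v := by
    conv_lhs => rw [hβc]
    simp [Finsupp.sum]
  rw [e]
  rcases hs with hs | hs
  · refine (Finset.sum_pos (fun δ hδ => mul_pos ?_ (hv δ (hc hδ))) hne).ne'
    exact_mod_cast (hs δ).lt_of_ne' (Finsupp.mem_support_iff.1 hδ)
  · refine (Finset.sum_neg (fun δ hδ => mul_neg_of_neg_of_pos ?_ (hv δ (hc hδ))) hne).ne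
    exact_mod_cast (hs δ).lt_of_ne (Finsupp.mem_support_iff.1 hδ)

lemma apply_le_highest (h : IsBaseWithHighestRoot R Δ αt) {β : Module.Dual ℚ V}
    (hβ : β ∈ R.Φ) {v : V} (hv : ∀ δ ∈ Δ, 0 ≤ δ v) : β v ≤ αt v := by
  obtain ⟨c, hc, e, hs⟩ := h.highest β hβ
  have e' := congrArg (fun f : Module.Dual ℚ V => f v) e
  simp only [Finsupp.sum, LinearMap.sum_apply, LinearMap.smul_apply, smul_eq_mul,
    LinearMap.sub_apply] at e'
  rw [← sub_nonneg, e']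
  exact Finset.sum_nonneg fun δ hδ => mul_nonneg (hs δ) (hv δ (hc hδ))

lemma highest_nonneg (h : IsBaseWithHighestRoot R Δ αt) {v : V} (hv : ∀ δ ∈ Δ, 0 ≤ δ v) :
    0 ≤ αt v := by
  have := h.apply_le_highest (R.neg_mem h.highest_mem) hv
  rw [LinearMap.neg_apply] at this
  linarith

lemma exists_apply_eq [FiniteDimensional ℚ V] (h : IsBaseWithHighestRoot R Δ αt)
    (f : Module.Dual ℚ V → ℚ) : ∃ v : V, ∀ δ ∈ Δ, δ v = f δ := by
  obtain ⟨φ, hφ⟩ : ∃ φ : Module.Dual ℚ (Module.Dual ℚ V), ∀ δ ∈ Δ, φ δ = f δ := by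
    have hind : LinearIndepOn ℚ id (Δ : Set (Module.Dual ℚ V)) := h.linearIndependent
    refine ⟨(Basis.extend hind).constr ℚ fun i => f i, fun δ hδ => ?_⟩
    have := (Basis.extend hind).constr_basis ℚ (fun i => f i) ⟨δ, hind.subset_extend _ hδ⟩
    rwa [Basis.extend_apply_self] at this
  refine ⟨(Module.evalEquiv ℚ V).symm φ, fun δ hδ => ?_⟩
  rw [Module.apply_evalEquiv_symm_apply, hφ δ hδ]

/-- A root is bounded by `0` and `1`, or by `-1` and `0`, on the alcove; the inequalities are
strict at points where no root takes an integral value. -/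
lemma apply_mem_Icc (h : IsBaseWithHighestRoot R Δ αt) {β : Module.Dual ℚ V} (hβ : β ∈ R.Φ)
    {p c : V} (hp : p ∈ alcove Δ αt) (hpr : ∀ β ∈ R.Φ, ∀ n : ℤ, β p ≠ n)
    (hc : c ∈ alcove Δ αt) :
    (0 < β p ∧ β p < 1 ∧ 0 ≤ β c ∧ β c ≤ 1) ∨ (-1 < β p ∧ β p < 0 ∧ -1 ≤ β c ∧ β c ≤ 0) := by
  rw [h.mem_alcove_iff] at hp hc
  have h0 : β p ≠ 0 := by exact_mod_cast hpr β hβ 0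
  have h1 : β p ≠ 1 := by exact_mod_cast hpr β hβ 1
  have h2 : β p ≠ -1 := by exact_mod_cast hpr β hβ (-1)
  have a1 := h.apply_le_highest hβ hp.1
  have a2 := h.apply_le_highest hβ hc.1
  have a3 := h.apply_le_highest (R.neg_mem hβ) hp.1
  have a4 := h.apply_le_highest (R.neg_mem hβ) hc.1
  rw [LinearMap.neg_apply] at a3 a4
  refine (h.nonneg_or_nonpos hβ).imp (fun hs => ?_) (fun hs => ?_)
  · exact ⟨(hs p hp.1).lt_of_ne' h0, (a1.trans hp.2).lt_of_ne h1, hs c hc.1, a2.trans hc.2⟩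
  · exact ⟨lt_of_le_of_ne (by linarith) h2.symm, (hs p hp.1).lt_of_ne h0, by linarith,
      hs c hc.1⟩

lemma exists_regular_mem_alcove [FiniteDimensional ℚ V] (h : IsBaseWithHighestRoot R Δ αt) :
    ∃ p ∈ alcove Δ αt, ∀ β ∈ R.Φ, ∀ n : ℤ, β p ≠ n := by
  obtain ⟨p, hp⟩ := h.exists_apply_eq fun _ => 1
  have hp' : ∀ δ ∈ Δ, 0 < δ p := fun δ hδ => by rw [hp δ hδ]; exact one_pos
  have hp0 : ∀ δ ∈ Δ, 0 ≤ δ p := fun δ hδ => (hp' δ hδ).le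
  have hK : 0 ≤ αt p := h.highest_nonneg hp0
  have hK1 : 0 < αt p + 1 := by linarith
  refine ⟨(αt p + 1)⁻¹ • p, h.mem_alcove_iff.2 ⟨fun δ hδ => ?_, ?_⟩, fun β hβ n hn => ?_⟩
  · rw [map_smul, smul_eq_mul]
    exact mul_nonneg (inv_nonneg.2 hK1.le) (hp0 δ hδ)
  · rw [map_smul, smul_eq_mul, inv_mul_le_iff₀ hK1]
    linarith
  · rw [map_smul, smul_eq_mul, inv_mul_eq_iff_eq_mul₀ hK1.ne'] at hn
    have b1 := h.apply_le_highest hβ hp0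
    have b2 := h.apply_le_highest (R.neg_mem hβ) hp0
    rw [LinearMap.neg_apply] at b2
    rw [hn] at b1 b2
    have n1 : (n : ℚ) < 1 := by
      by_contra! hc
      nlinarith
    have n2 : (-1 : ℚ) < n := by
      by_contra! hc
      nlinarith
    have n3 : n < 1 := by exact_mod_cast n1
    have n4 : -1 < n := by exact_mod_cast n2
    obtain rfl : n = 0 := by omega
    exact h.apply_ne_zero hβ hp' (by simpa using hn)

/-- Every wall of the alcove has a point that lies on no other wall. -/
lemma exists_mem_unique_wall [FiniteDimensional ℚ V] (h : IsBaseWithHighestRoot R Δ αt)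
    {α : Module.Dual ℚ V} (hα : α ∈ extBase Δ αt) :
    ∃ q ∈ alcove Δ αt, α q = mfun αt α ∧ ∀ δ ∈ extBase Δ αt, δ ≠ α → mfun αt δ < δ q := by
  classical
  suffices H : ∃ q, α q = mfun αt α ∧ ∀ δ ∈ extBase Δ αt, δ ≠ α → mfun αt δ < δ q by
    obtain ⟨q, h1, h2⟩ := H
    refine ⟨q, fun δ hδ => ?_, h1, h2⟩
    by_cases e : δ = α
    · rw [e, h1]
    · exact (h2 δ hδ e).le
  rcases hα with rfl | hα
  · obtain ⟨p, hp⟩ := h.exists_apply_eq fun _ => 1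
    have hp' : ∀ δ ∈ Δ, 0 < δ p := fun δ hδ => by rw [hp δ hδ]; exact one_pos
    have hK : 0 < αt p := (h.highest_nonneg fun δ hδ => (hp' δ hδ).le).lt_of_ne'
      (h.apply_ne_zero h.highest_mem hp')
    refine ⟨(αt p)⁻¹ • p, ?_, ?_⟩
    · rw [mfun_neg_self, map_smul, LinearMap.neg_apply, smul_eq_mul, mul_neg,
        inv_mul_cancel₀ hK.ne']
    · rintro δ (rfl | hδ) hne
      · exact absurd rfl hne
      · rw [h.mfun_of_mem hδ, map_smul, smul_eq_mul]
        exact mul_pos (inv_pos.2 hK) (hp' δ hδ)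
  · obtain ⟨p, hp⟩ := h.exists_apply_eq fun δ => if δ = α then 0 else 1
    have hp' : ∀ δ ∈ Δ, 0 ≤ δ p := fun δ hδ => by rw [hp δ hδ]; split_ifs <;> norm_num
    have hK : 0 ≤ αt p := h.highest_nonneg hp'
    have hK1 : 0 < αt p + 1 := by linarith
    refine ⟨(αt p + 1)⁻¹ • p, ?_, ?_⟩
    · rw [h.mfun_of_mem hα, map_smul, hp α hα, if_pos rfl, smul_zero]
    · rintro δ (rfl | hδ) hne
      · rw [mfun_neg_self, map_smul, LinearMap.neg_apply, smul_eq_mul, mul_neg, neg_lt_neg_iff,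
          inv_mul_lt_iff₀ hK1]
        linarith
      · rw [h.mfun_of_mem hδ, map_smul, smul_eq_mul, hp δ hδ, if_neg hne]
        exact mul_pos (inv_pos.2 hK1) one_pos

/-- If `φ` attains its minimum over the alcove at `q`, then `φ` vanishes on the directions
common to all walls through `q`. -/
lemma apply_eq_zero_of_isMinOn {φ : Module.Dual ℚ V} {q u : V} (hq : q ∈ alcove Δ αt)
    (hφ : ∀ c ∈ alcove Δ αt, φ q ≤ φ c)
    (hu : ∀ δ ∈ extBase Δ αt, δ q = mfun αt δ → δ u = 0) : φ u = 0 := by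
  suffices H : ∀ u : V, (∀ δ ∈ extBase Δ αt, δ q = mfun αt δ → δ u = 0) → 0 ≤ φ u by
    have h1 := H u hu
    have h2 := H (-u) fun δ hδ hδq => by rw [map_neg, hu δ hδ hδq, neg_zero]
    rw [map_neg] at h2
    linarith
  intro u hu
  have hev : ∀ᶠ ε : ℚ in nhdsWithin 0 (Set.Ioi 0), ∀ δ ∈ extBase Δ αt,
      mfun αt δ ≤ δ (q + ε • u) := by
    refine (Filter.eventually_all_finite (Δ.finite_toSet.insert (-αt))).2 fun δ hδ => ?_
    rcases (hq δ hδ).eq_or_lt with e | hlt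
    · refine Filter.Eventually.of_forall fun ε => ?_
      rw [map_add, map_smul, hu δ hδ e.symm, smul_zero, add_zero, e]
    · have hcont : Continuous fun ε : ℚ => δ q + ε * δ u := by fun_prop
      have := (hcont.tendsto 0).eventually (lt_mem_nhds (by simpa using hlt))
      filter_upwards [nhdsWithin_le_nhds this] with ε hε
      rw [map_add, map_smul, smul_eq_mul]
      exact hε.le
  obtain ⟨ε, hε, hε0⟩ := (hev.and self_mem_nhdsWithin).exists
  have := hφ _ hε
  rw [map_add, map_smul, smul_eq_mul] at this
  exact nonneg_of_mul_nonneg_right (by linarith) hε0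

/-- If an element of the extended affine Weyl group maps one regular point of the alcove into
the alcove, it maps the whole alcove into itself. -/
lemma map_mem_alcove (h : IsBaseWithHighestRoot R Δ αt) {z : V ≃ₗ[ℚ] V} (hz : z ∈ weyl R)
    {v : V} (hv : v ∈ coweightSet R) {p : V} (hp : p ∈ alcove Δ αt)
    (hpr : ∀ β ∈ R.Φ, ∀ n : ℤ, β p ≠ n) (hzp : z p + v ∈ alcove Δ αt) {c : V}
    (hc : c ∈ alcove Δ αt) : z c + v ∈ alcove Δ αt := by
  intro α hα
  have hαΦ := h.extBase_subset hα
  obtain ⟨n, hn⟩ := hv α hαΦ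
  obtain ⟨m, hm⟩ := exists_int_eq_mfun αt α
  have key := (le_add_int_of_mem_Icc
    (h.apply_mem_Icc ((R.comp_mem_of_mem_weyl hz).1 α hαΦ) hp hpr hc) n m).1
  have hzpα := hzp α hα
  rw [map_add, ← hn, ← hm] at hzpα ⊢
  exact key hzpα

/-- An element of the extended affine Weyl group that maps one regular point of the alcove
into the alcove stabilizes the alcove. -/
lemma image_alcove_eq (h : IsBaseWithHighestRoot R Δ αt) {z : V ≃ₗ[ℚ] V} (hz : z ∈ weyl R)
    {v : V} (hv : v ∈ coweightSet R) {p : V} (hp : p ∈ alcove Δ αt)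
    (hpr : ∀ β ∈ R.Φ, ∀ n : ℤ, β p ≠ n) (hzp : z p + v ∈ alcove Δ αt) :
    (fun x => z x + v) '' alcove Δ αt = alcove Δ αt := by
  refine Set.Subset.antisymm ?_ fun c hc => ?_
  · rintro _ ⟨c, hc, rfl⟩
    exact h.map_mem_alcove hz hv hp hpr hzp hc
  · have hinv := (weyl R).inv_mem hz
    refine ⟨z⁻¹ c + -z⁻¹ v, ?_, ?_⟩
    · refine h.map_mem_alcove hinv (fun β hβ => ?_) hzp (fun β hβ n hn => ?_) ?_ hc
      · obtain ⟨n, hn⟩ := hv _ ((R.comp_mem_of_mem_weyl hinv).1 β hβ)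
        refine ⟨-n, ?_⟩
        rw [map_neg, Int.cast_neg, hn]
        rfl
      · obtain ⟨k, hk⟩ := hv β hβ
        refine hpr _ ((R.comp_mem_of_mem_weyl hz).1 β hβ) (n - k) ?_
        rw [map_add, ← hk] at hn
        rw [Int.cast_sub, ← hn, add_sub_cancel_right]
        rfl
      · rw [map_add, add_neg_cancel_right]
        rwa [← LinearEquiv.mul_apply, inv_mul_cancel, LinearEquiv.coe_one, id_eq]
    · change z (z⁻¹ c + -z⁻¹ v) + v = c
      rw [map_add, map_neg, ← LinearEquiv.mul_apply, ← LinearEquiv.mul_apply, mul_inv_cancel]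
      simp

/-- The linear part of a stabilizer of the alcove permutes the extended base. -/
lemma dact_image_extBase [FiniteDimensional ℚ V] (h : IsBaseWithHighestRoot R Δ αt)
    {z : V ≃ₗ[ℚ] V} (hz : z ∈ weyl R) {v : V}
    (hzv : (fun x => z x + v) '' alcove Δ αt = alcove Δ αt) :
    dact z '' extBase Δ αt = extBase Δ αt := by
  have hfin : (extBase Δ αt).Finite := Δ.finite_toSet.insert _
  suffices H : extBase Δ αt ⊆ dact z '' extBase Δ αt from
    (Set.eq_of_subset_of_ncard_le H (Set.ncard_image_le hfin) (hfin.image _)).symm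
  intro α hα
  have hαΦ := h.extBase_subset hα
  obtain ⟨q, hq, hqα, hqne⟩ := h.exists_mem_unique_wall hα
  obtain ⟨r, hr, hrq⟩ := hzv.ge hq
  replace hrq : z r + v = q := hrq
  have hzmem {c : V} (hc : c ∈ alcove Δ αt) : z c + v ∈ alcove Δ αt :=
    hzv.le (Set.mem_image_of_mem _ hc)
  obtain ⟨δ, hδ, hδr⟩ : ∃ δ ∈ extBase Δ αt, δ r = mfun αt δ := by
    by_contra! hne
    refine R.ne_zero ((R.comp_mem_of_mem_weyl hz).1 α hαΦ) (LinearMap.ext fun u => ?_)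
    refine apply_eq_zero_of_isMinOn hr (fun c hc => ?_) fun δ hδ e => absurd e (hne δ hδ)
    have := hzmem hc α hα
    rw [← hqα, ← hrq, map_add, map_add] at this
    exact le_of_add_le_add_right this
  refine ⟨δ, hδ, ?_⟩
  have hδΦ := h.extBase_subset hδ
  have hmin : ∀ c ∈ alcove Δ αt, dact z δ q ≤ dact z δ c := by
    intro c hc
    obtain ⟨c', hc', hcc⟩ := hzv.ge hc
    replace hcc : z c' + v = c := hcc
    have := hc' δ hδ
    rw [← hδr] at this
    rw [← hcc, ← hrq, map_add, map_add]
    simpa [dact] using this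
  have hker : ∀ u, α u = 0 → dact z δ u = 0 := fun u hu =>
    apply_eq_zero_of_isMinOn hq hmin fun ε hε e => by
      by_cases hεα : ε = α
      · rw [hεα, hu]
      · exact absurd e (hqne ε hε hεα).ne'
  obtain ⟨c, hc⟩ : ∃ c : ℚ, c • α = dact z δ := by
    refine ⟨dact z δ (R.coroot α) / 2, LinearMap.ext fun u => ?_⟩
    have := hker (u - (α u / 2) • R.coroot α) (by
      rw [map_sub, map_smul, R.pairing_self α hαΦ, smul_eq_mul]; ring)
    rw [map_sub, map_smul, smul_eq_mul] at this
    rw [LinearMap.smul_apply, smul_eq_mul]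
    linarith
  rcases R.reduced α hαΦ c (hc ▸ (R.comp_mem_of_mem_weyl hz).2 δ hδΦ) with rfl | rfl
  · rw [← hc, one_smul]
  · obtain ⟨p, hp, hpr⟩ := h.exists_regular_mem_alcove
    obtain ⟨m, hm⟩ := exists_int_eq_mfun αt α
    have h1 := hmin p hp
    rw [← hc] at h1
    simp only [LinearMap.smul_apply, smul_eq_mul] at h1
    exact absurd (le_antisymm (by linarith) (hp α hα)) (hm ▸ hpr α hαΦ m)

/-- An element of `W ⋉ L` mapping `x ∈ C` to `y ∈ C` can be modified by reflections fixing `y`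
so that it maps a given regular point of `C` into `C`. -/
lemma exists_map_mem_alcove (h : IsBaseWithHighestRoot R Δ αt) {L : AddSubgroup V}
    (hQL : (corootLattice R : Set V) ⊆ (L : Set V)) (hLP : (L : Set V) ⊆ coweightSet R)
    {x y p : V} (hx : x ∈ alcove Δ αt) (hy : y ∈ alcove Δ αt) (hp : p ∈ alcove Δ αt)
    (hpr : ∀ β ∈ R.Φ, ∀ n : ℤ, β p ≠ n) {w : V ≃ₗ[ℚ] V} (hw : w ∈ weyl R) {l : V}
    (hl : l ∈ L) (hwx : w x + l = y) :
    ∃ z ∈ weyl R, ∃ v ∈ L, z x + v = y ∧ z p + v ∈ alcove Δ αt := by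
  obtain ⟨N, hN0, hN⟩ := R.exists_common_denominator p
  obtain ⟨n, hn⟩ := R.exists_nat_eq_mul_form hN hw (hLP hl)
  induction n using Nat.strong_induction_on generalizing w l with
  | _ n ih =>
  by_cases hmem : w p + l ∈ alcove Δ αt
  · exact ⟨w, hw, l, hl, hwx, hmem⟩
  obtain ⟨α, hα, hlt⟩ : ∃ α ∈ extBase Δ αt, α (w p + l) < mfun αt α := by
    by_contra! hc
    exact hmem hc
  have hαΦ := h.extBase_subset hα
  obtain ⟨m, hm⟩ := exists_int_eq_mfun αt α
  obtain ⟨k, hk⟩ := hLP hl α hαΦ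
  have hαp : (m : ℚ) < α p := (hm ▸ hp α hα).lt_of_ne (hpr α hαΦ m).symm
  have hαy : α y = m := by
    refine le_antisymm ?_ (hm ▸ hy α hα)
    have key := (le_add_int_of_mem_Icc
      (h.apply_mem_Icc ((R.comp_mem_of_mem_weyl hw).1 α hαΦ) hp hpr hx) k m).2
    rw [map_add, ← hk, ← hm] at hlt
    rw [← hwx, map_add, ← hk]
    exact key hlt
  rw [← hm] at hlt
  have hmap (c : V) : (R.refl hαΦ * w) c + (l - (α l - m) • R.coroot α) =
      w c + l - (α (w c + l) - m) • R.coroot α := by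
    rw [LinearEquiv.mul_apply, R.refl_apply, map_add]
    module
  have hw' := (weyl R).mul_mem (R.refl_mem_weyl hαΦ) hw
  have hl' : l - (α l - m) • R.coroot α ∈ L := by
    rw [← hk, ← Int.cast_sub, Int.cast_smul_eq_zsmul]
    exact L.sub_mem hl (L.zsmul_mem (hQL (AddSubgroup.subset_closure ⟨α, hαΦ, rfl⟩)) _)
  obtain ⟨n', hn'⟩ := R.exists_nat_eq_mul_form hN hw' (hLP hl')
  refine ih n' ?_ hw' hl' ?_ hn'
  · have hN2 : (0 : ℚ) < N ^ 2 := by positivity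
    rw [← Nat.cast_lt (α := ℚ), hn, hn', hmap]
    exact mul_lt_mul_of_pos_left (R.form_affine_refl_lt hαΦ hαp hlt) hN2
  · rw [hmap, hwx, hαy, sub_self, zero_smul, sub_zero]

end IsBaseWithHighestRoot

/-- Two elements λ, μ of C lie in the same orbit under the affine
transformations v ↦ w(v) + l (w ∈ W, l ∈ L) if and only if there is z ∈ 𝒜_L with
z(λ) − μ ∈ L. -/
theorem alcove_same_orbit_iff
    {V : Type*} [AddCommGroup V] [Module ℚ V] [FiniteDimensional ℚ V]
    (R : RootSystemData V)
    (Δ : Finset (Module.Dual ℚ V))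
    (hΔΦ : (Δ : Set (Module.Dual ℚ V)) ⊆ R.Φ)
    (hΔind : LinearIndependent ℚ
      (fun x : (Δ : Set (Module.Dual ℚ V)) => (x : Module.Dual ℚ V)))
    (hΔbase : ∀ α ∈ R.Φ, ∃ c : Module.Dual ℚ V →₀ ℤ,
        (c.support : Set (Module.Dual ℚ V)) ⊆ (Δ : Set (Module.Dual ℚ V)) ∧
        α = c.sum (fun β k => (k : ℚ) • β) ∧
        ((∀ β, 0 ≤ c β) ∨ (∀ β, c β ≤ 0)))
    (αt : Module.Dual ℚ V) (hαtΦ : αt ∈ R.Φ)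
    (hhigh : ∀ γ ∈ R.Φ, ∃ c : Module.Dual ℚ V →₀ ℚ,
        (c.support : Set (Module.Dual ℚ V)) ⊆ (Δ : Set (Module.Dual ℚ V)) ∧
        αt - γ = c.sum (fun β k => k • β) ∧ (∀ β, 0 ≤ c β))
    (hα₀ : -αt ∉ (Δ : Set (Module.Dual ℚ V)))
    (L : AddSubgroup V)
    (hQL : (corootLattice R : Set V) ⊆ (L : Set V))
    (hLP : (L : Set V) ⊆ coweightSet R)
    (x y : V) (hx : x ∈ alcove Δ αt) (hy : y ∈ alcove Δ αt) :
    (∃ w ∈ weyl R, ∃ l ∈ L, w x + l = y) ↔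
    (∃ z ∈ AutTildeL R Δ αt L, z x - y ∈ L) := by
  have h : IsBaseWithHighestRoot R Δ αt := ⟨hΔΦ, hΔind, hΔbase, hαtΦ, hhigh, hα₀⟩
  constructor
  · rintro ⟨w, hw, l, hl, hwx⟩
    obtain ⟨p, hp, hpr⟩ := h.exists_regular_mem_alcove
    obtain ⟨z, hz, v, hv, hzx, hzp⟩ := h.exists_map_mem_alcove hQL hLP hx hy hp hpr hw hl hwx
    have himg := h.image_alcove_eq hz (hLP hv) hp hpr hzp
    refine ⟨z, ⟨⟨hz, h.dact_image_extBase hz himg⟩, v, hv, himg⟩, ?_⟩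
    rw [← hzx, sub_add_cancel_left]
    exact L.neg_mem hv
  · rintro ⟨z, ⟨⟨hz, -⟩, -⟩, hzy⟩
    exact ⟨z, hz, -(z x - y), L.neg_mem hzy, by abel⟩
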